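/- arXiv:2105.09547 — 2 statements merged into one kernel-verified Lean document; each statement's English description precedes it below -/
import Mathlib

section
/- With the standing setup, fix 0 ≤ v ≤ ℓ−1 and write R' = R/Rπ^{ℓ−v}, a finite chain ring with radical R'π' of nilpotency index ℓ−v, where π' and λ' denote the images of π and λ in R'. Then the map sending π^v·a(X) (for a(X) ∈ 𝓡) to a'(X) = a(X) mod π^{ℓ−v} is a well-defined 𝓡-module isomorphism from the ideal 𝓡π^v onto R'[X]/⟨X^n−λ'⟩, and it preserves Hamming weight: w_H(π^v a(X)) = w_H(a'(X)). -/
set_option maxHeartbeats 1000000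
open Polynomial

/-- The Hamming weight of an element of `S[X]/⟨g⟩` (`g` monic of degree `n`): the number of
nonzero coefficients of its unique representative of degree `< n`, obtained by reducing any
representative mod the monic polynomial `g`. -/
noncomputable def hammingWt {S : Type*} [CommRing S] (g : Polynomial S)
    (c : Polynomial S ⧸ Ideal.span {g}) : ℕ :=
  ((Quotient.out c) %ₘ g).support.card

theorem hammingWt_mk {S : Type*} [CommRing S] {g : Polynomial S} (hg : g.Monic)
    (a : Polynomial S) :
    hammingWt g (Ideal.Quotient.mk (Ideal.span {g}) a) = (a %ₘ g).support.card := by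
  unfold hammingWt
  have h : (Ideal.Quotient.mk (Ideal.span {g}))
      (Quotient.out (Ideal.Quotient.mk (Ideal.span {g}) a)) =
      Ideal.Quotient.mk (Ideal.span {g}) a := Quotient.out_eq _
  rw [Ideal.Quotient.eq, Ideal.mem_span_singleton,
    ← Polynomial.modByMonic_eq_zero_iff_dvd hg, Polynomial.sub_modByMonic, sub_eq_zero] at h
  rw [h]

theorem exists_addEquiv_of_surjective_of_ker_iff {G H K : Type*} [AddCommGroup G]
    [AddCommGroup H] [AddCommGroup K] (φ : G →+ H) (ψ : G →+ K)
    (hφ : Function.Surjective φ) (hψ : Function.Surjective ψ)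
    (h : ∀ a, φ a = 0 ↔ ψ a = 0) :
    ∃ ε : H ≃+ K, ∀ a, ε (φ a) = ψ a := by
  have hker : φ.ker = ψ.ker := by
    ext a
    exact h a
  refine ⟨((QuotientAddGroup.quotientKerEquivOfSurjective φ hφ).symm.trans
    (QuotientAddGroup.quotientAddEquivOfEq hker)).trans
    (QuotientAddGroup.quotientKerEquivOfSurjective ψ hψ), fun a => ?_⟩
  have ha : (QuotientAddGroup.quotientKerEquivOfSurjective φ hφ).symm (φ a) =
      (a : G ⧸ φ.ker) := by
    rw [AddEquiv.symm_apply_eq]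
    rfl
  simp only [AddEquiv.trans_apply, ha]
  rfl

theorem isLocalRing_of_ideal_total {R : Type*} [CommRing R] [Nontrivial R]
    (hchain : ∀ I J : Ideal R, I ≤ J ∨ J ≤ I) : IsLocalRing R := by
  refine IsLocalRing.of_nonunits_add fun a b ha hb hab => ?_
  rcases hchain (Ideal.span {a}) (Ideal.span {b}) with h | h <;>
    rw [Ideal.span_singleton_le_span_singleton] at h
  · exact hb (isUnit_of_dvd_unit (dvd_add h dvd_rfl) hab)
  · exact ha (isUnit_of_dvd_unit (dvd_add dvd_rfl h) hab)

/-- In a chain ring with radical generated by `π` of nilpotency index `ℓ`, the annihilator of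
`π ^ v` is generated by `π ^ (ℓ - v)`. -/
theorem pow_mul_eq_zero_iff_mem_span {R : Type*} [CommRing R]
    (hchain : ∀ I J : Ideal R, I ≤ J ∨ J ≤ I) {π : R}
    (hJ : Ideal.jacobson (⊥ : Ideal R) = Ideal.span {π}) {ℓ v : ℕ}
    (hnil : π ^ ℓ = 0) (hnil' : π ^ (ℓ - 1) ≠ 0) (hv : v ≤ ℓ) (x : R) :
    π ^ v * x = 0 ↔ x ∈ Ideal.span {π ^ (ℓ - v)} := by
  have : Nontrivial R := ⟨_, _, hnil'⟩
  have := isLocalRing_of_ideal_total hchain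
  rw [IsLocalRing.jacobson_eq_maximalIdeal ⊥ bot_ne_top] at hJ
  rw [Ideal.mem_span_singleton]
  constructor
  · intro hx
    rcases hchain (Ideal.span {x}) (Ideal.span {π ^ (ℓ - v)}) with h | h <;>
      rw [Ideal.span_singleton_le_span_singleton] at h
    · exact h
    obtain ⟨y, hy⟩ := h
    by_cases hu : IsUnit y
    · rw [hy]
      exact (hu.mul_right_dvd).2 dvd_rfl
    have hy' : y ∈ Ideal.span {π} := hJ ▸ (IsLocalRing.mem_maximalIdeal y).2 hu
    obtain ⟨z, rfl⟩ := Ideal.mem_span_singleton.1 hy'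
    rcases Nat.eq_zero_or_pos v with rfl | hv0
    · rw [pow_zero, one_mul] at hx
      simp [hx]
    refine absurd ?_ hnil'
    calc π ^ (ℓ - 1) = π ^ (v - 1) * π ^ (ℓ - v) := by
          rw [← pow_add]
          congr 1
          omega
      _ = π ^ (v - 1 + 1) * x * z := by
          rw [hy]
          ring
      _ = 0 := by rw [Nat.sub_add_cancel hv0, hx, zero_mul]
  · rintro ⟨y, rfl⟩
    rw [← mul_assoc, ← pow_add, Nat.add_sub_cancel' hv, hnil, zero_mul]

/-- With the standing setup, fix `0 ≤ v ≤ ℓ−1` and write `R' = R/Rπ^{ℓ−v}`, a finite chain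
ring with radical `R'π'` of nilpotency index `ℓ−v` (`π'`, `λ'` the images of `π`, `λ`).
Then `π^v·a(X) ↦ a'(X) = a(X) mod π^{ℓ−v}` is a well-defined `𝓡`-module isomorphism from
the ideal `𝓡π^v` onto `R'[X]/⟨X^n−λ'⟩`, preserving Hamming weight. -/
theorem stmt_9 {R : Type*} [CommRing R] [Fintype R]
    (hchain : ∀ I J : Ideal R, I ≤ J ∨ J ≤ I)
    (π : R) (hJ : Ideal.jacobson (⊥ : Ideal R) = Ideal.span {π})
    (ℓ : ℕ) (hℓ : 0 < ℓ) (hnil : π ^ ℓ = 0) (hnil' : π ^ (ℓ - 1) ≠ 0)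
    (p r : ℕ) (hp : p.Prime) (hcard : Nat.card (R ⧸ Ideal.span {π}) = p ^ r)
    (n : ℕ) (hn : 1 < n) (hnp : Nat.Coprime n p)
    (lam : R) (hlam : IsUnit lam)
    (v : ℕ) (hv : v ≤ ℓ - 1) :
    -- `R' = R/Rπ^{ℓ−v}` is a finite chain ring with radical `R'π'` of nilpotency index `ℓ−v`
    (∀ I J : Ideal (R ⧸ Ideal.span {π ^ (ℓ - v)}), I ≤ J ∨ J ≤ I) ∧
    Ideal.jacobson (⊥ : Ideal (R ⧸ Ideal.span {π ^ (ℓ - v)})) =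
      Ideal.span {Ideal.Quotient.mk (Ideal.span {π ^ (ℓ - v)}) π} ∧
    (Ideal.Quotient.mk (Ideal.span {π ^ (ℓ - v)}) π) ^ (ℓ - v) = 0 ∧
    (Ideal.Quotient.mk (Ideal.span {π ^ (ℓ - v)}) π) ^ (ℓ - v - 1) ≠ 0 ∧
    -- the isomorphism `𝓡π^v ≅ R'[X]/⟨X^n−λ'⟩`
    ∃ ε : ↥(Ideal.span {Ideal.Quotient.mk (Ideal.span {X ^ n - Polynomial.C lam})
            (Polynomial.C (π ^ v))}) ≃+
          (Polynomial (R ⧸ Ideal.span {π ^ (ℓ - v)}) ⧸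
            Ideal.span {X ^ n -
              Polynomial.C (Ideal.Quotient.mk (Ideal.span {π ^ (ℓ - v)}) lam)}),
      -- it sends `π^v·a(X)` to `a'(X) = a(X) mod π^{ℓ−v}`
      (∀ (a : Polynomial R)
        (hmem : Ideal.Quotient.mk (Ideal.span {X ^ n - Polynomial.C lam})
            (Polynomial.C (π ^ v) * a) ∈
          Ideal.span {Ideal.Quotient.mk (Ideal.span {X ^ n - Polynomial.C lam})
            (Polynomial.C (π ^ v))}),
        ε ⟨Ideal.Quotient.mk (Ideal.span {X ^ n - Polynomial.C lam})
            (Polynomial.C (π ^ v) * a), hmem⟩ =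
          Ideal.Quotient.mk (Ideal.span {X ^ n -
              Polynomial.C (Ideal.Quotient.mk (Ideal.span {π ^ (ℓ - v)}) lam)})
            (a.map (Ideal.Quotient.mk (Ideal.span {π ^ (ℓ - v)})))) ∧
      -- it is `𝓡`-linear (semilinear over the coefficient-reduction map)
      (∀ (b : Polynomial R)
        (w : ↥(Ideal.span {Ideal.Quotient.mk (Ideal.span {X ^ n - Polynomial.C lam})
            (Polynomial.C (π ^ v))})),
        ε (Ideal.Quotient.mk (Ideal.span {X ^ n - Polynomial.C lam}) b • w) =
          Ideal.Quotient.mk (Ideal.span {X ^ n -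
              Polynomial.C (Ideal.Quotient.mk (Ideal.span {π ^ (ℓ - v)}) lam)})
            (b.map (Ideal.Quotient.mk (Ideal.span {π ^ (ℓ - v)}))) * ε w) ∧
      -- it preserves Hamming weight
      (∀ w : ↥(Ideal.span {Ideal.Quotient.mk (Ideal.span {X ^ n - Polynomial.C lam})
            (Polynomial.C (π ^ v))}),
        hammingWt (X ^ n - Polynomial.C lam) (w : Polynomial R ⧸
            Ideal.span {X ^ n - Polynomial.C lam}) =
          hammingWt (X ^ n -
              Polynomial.C (Ideal.Quotient.mk (Ideal.span {π ^ (ℓ - v)}) lam)) (ε w)) := by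
  have hR : Nontrivial R := ⟨_, _, hnil'⟩
  have hloc := isLocalRing_of_ideal_total hchain
  have hann := pow_mul_eq_zero_iff_mem_span hchain hJ hnil hnil' (show v ≤ ℓ by omega)
  set K : Ideal R := Ideal.span {π ^ (ℓ - v)} with hK
  have hsurj : Function.Surjective (Ideal.Quotient.mk K) := Ideal.Quotient.mk_surjective
  have hpow : (Ideal.Quotient.mk K π) ^ (ℓ - v - 1) ≠ 0 := by
    rw [← map_pow, Ne, Ideal.Quotient.eq_zero_iff_mem, ← hann, ← pow_add,
      show v + (ℓ - v - 1) = ℓ - 1 by omega]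
    exact hnil'
  have hKtop : K ≠ ⊤ := by
    intro h
    apply hpow
    rw [← map_pow, Ideal.Quotient.eq_zero_iff_mem, h]
    trivial
  have hR' : Nontrivial (R ⧸ K) := Ideal.Quotient.nontrivial_iff.2 hKtop
  refine ⟨fun I J => ?_, ?_, ?_, hpow, ?_⟩
  · rw [← Ideal.comap_le_comap_iff_of_surjective _ hsurj,
      ← Ideal.comap_le_comap_iff_of_surjective _ hsurj]
    exact hchain _ _
  · have h := Ideal.map_jacobson_of_surjective hsurj (I := K) (Ideal.mk_ker (I := K)).le
    rw [Ideal.map_quotient_self, IsLocalRing.jacobson_eq_maximalIdeal K hKtop,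
      ← IsLocalRing.jacobson_eq_maximalIdeal ⊥ bot_ne_top, hJ, Ideal.map_span,
      Set.image_singleton] at h
    exact h.symm
  · rw [← map_pow, Ideal.Quotient.eq_zero_iff_mem]
    exact Ideal.mem_span_singleton_self _
  have hf : (X ^ n - C lam : R[X]).Monic := monic_X_pow_sub_C lam (by omega)
  have hf' : (X ^ n - C (Ideal.Quotient.mk K lam) : (R ⧸ K)[X]).Monic :=
    monic_X_pow_sub_C _ (by omega)
  have hmap : (X ^ n - C lam : R[X]).map (Ideal.Quotient.mk K) =
      X ^ n - C (Ideal.Quotient.mk K lam) := by simp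
  set f : R[X] := X ^ n - C lam
  set f' : (R ⧸ K)[X] := X ^ n - C (Ideal.Quotient.mk K lam)
  have hsupp (a : R[X]) : ((C (π ^ v) * a) %ₘ f).support =
      (a.map (Ideal.Quotient.mk K) %ₘ f').support := by
    rw [← hmap, ← map_modByMonic _ hf, ← smul_eq_C_mul, smul_modByMonic]
    ext i
    rw [mem_support_iff, mem_support_iff, coeff_smul, coeff_map, smul_eq_mul, Ne, hann,
      Ne, Ideal.Quotient.eq_zero_iff_mem]
  set A := R[X] ⧸ Ideal.span {f}
  let I : Ideal A := Ideal.span {Ideal.Quotient.mk (Ideal.span {f}) (C (π ^ v))}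
  have hmemI (a : R[X]) : Ideal.Quotient.mk (Ideal.span {f}) (C (π ^ v) * a) ∈ I := by
    rw [map_mul]
    exact Ideal.mul_mem_right _ _ (Ideal.mem_span_singleton_self _)
  let φ : R[X] →+ I :=
    { toFun := fun a => ⟨Ideal.Quotient.mk (Ideal.span {f}) (C (π ^ v) * a), hmemI a⟩
      map_zero' := by simp
      map_add' := fun a b => by
        apply Subtype.ext
        simp [mul_add] }
  let ψ : R[X] →+ (R ⧸ K)[X] ⧸ Ideal.span {f'} :=
    ((Ideal.Quotient.mk (Ideal.span {f'})).comp
      (mapRingHom (Ideal.Quotient.mk K))).toAddMonoidHom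
  have hφ : Function.Surjective φ := by
    rintro ⟨w, hw⟩
    obtain ⟨c, rfl⟩ := Ideal.mem_span_singleton'.1 hw
    obtain ⟨b, rfl⟩ := Ideal.Quotient.mk_surjective c
    refine ⟨b, Subtype.ext ?_⟩
    change Ideal.Quotient.mk _ (C (π ^ v) * b) = _
    rw [map_mul, mul_comm]
  have hψ : Function.Surjective ψ :=
    Ideal.Quotient.mk_surjective.comp (map_surjective _ hsurj)
  have hker (a : R[X]) : φ a = 0 ↔ ψ a = 0 := by
    rw [Subtype.ext_iff]
    change Ideal.Quotient.mk (Ideal.span {f}) (C (π ^ v) * a) = 0 ↔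
      Ideal.Quotient.mk (Ideal.span {f'}) (a.map (Ideal.Quotient.mk K)) = 0
    rw [Ideal.Quotient.eq_zero_iff_dvd, Ideal.Quotient.eq_zero_iff_dvd,
      ← modByMonic_eq_zero_iff_dvd hf, ← modByMonic_eq_zero_iff_dvd hf',
      ← support_eq_empty, ← support_eq_empty, hsupp]
  obtain ⟨ε, hε⟩ := exists_addEquiv_of_surjective_of_ker_iff φ ψ hφ hψ hker
  refine ⟨ε, fun a _ => hε a, fun b w => ?_, fun w => ?_⟩
  · obtain ⟨a, rfl⟩ := hφ w
    have h : Ideal.Quotient.mk (Ideal.span {f}) b • φ a = φ (b * a) := by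
      apply Subtype.ext
      change Ideal.Quotient.mk (Ideal.span {f}) b *
        Ideal.Quotient.mk (Ideal.span {f}) (C (π ^ v) * a) =
        Ideal.Quotient.mk (Ideal.span {f}) (C (π ^ v) * (b * a))
      rw [← map_mul]
      congr 1
      ring
    rw [h, hε, hε]
    simp [ψ]
  · obtain ⟨a, rfl⟩ := hφ w
    rw [hε]
    change hammingWt f (Ideal.Quotient.mk (Ideal.span {f}) (C (π ^ v) * a)) =
      hammingWt f' (Ideal.Quotient.mk (Ideal.span {f'}) (a.map (Ideal.Quotient.mk K)))
    rw [hammingWt_mk hf, hammingWt_mk hf', hsupp]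
end

section
/- Let R be a finite chain ring with Jacobson radical J(R) = Rπ of nilpotency index ℓ, let n > 1 be an integer, and let λ be a unit of R with gcd(n, ord_{R^×}(λ)) = 1. Then R[X]/⟨X^n−λ⟩ is a principal ideal ring if and only if min{ℓ, gcd(n, char R)} = 1, i.e. if and only if either R is a field (ℓ = 1) or n is coprime to the characteristic of R. -/
open Polynomial

/-- An ideal generated by an idempotent and one more element is principal. -/
theorem Ideal.span_pair_eq_span_singleton_of_isIdempotentElem {S : Type*} [CommRing S] {e : S}
    (he : IsIdempotentElem e) (a : S) :
    Ideal.span {e, a} = Ideal.span {e + a * (1 - e)} := by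
  have he' : e * e = e := he
  apply le_antisymm
  · rw [Ideal.span_le, Set.insert_subset_iff, Set.singleton_subset_iff]
    constructor
    · exact Ideal.mem_span_singleton'.2 ⟨e, by linear_combination (1 - a) * he'⟩
    · exact Ideal.mem_span_singleton'.2 ⟨a * e + (1 - e), by
        linear_combination (a * (1 - a) - 1 + a) * he'⟩
  · rw [Ideal.span_singleton_le_iff_mem, Ideal.mem_span_pair]
    exact ⟨1, 1 - e, by ring⟩

/-- If `a` is nilpotent and `S ⧸ (a)` is reduced Artinian then `S` is a principal ideal ring. -/
theorem IsPrincipalIdealRing.of_isReduced_quotient_span_singleton {S : Type*} [CommRing S]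
    {a : S} (ha : IsNilpotent a) [IsArtinianRing (S ⧸ Ideal.span {a})]
    [IsReduced (S ⧸ Ideal.span {a})] : IsPrincipalIdealRing S := by
  refine IsPrincipalIdealRing.of_prime fun P hP ↦ ?_
  have haP : a ∈ P := hP.mem_of_pow_mem ha.choose (by rw [ha.choose_spec]; exact P.zero_mem)
  have hsurj := Ideal.Quotient.mk_surjective (I := Ideal.span {a})
  have := IsArtinianRing.isSemisimpleRing_of_isReduced (S ⧸ Ideal.span {a})
  obtain ⟨x, hxi, hx⟩ := IsSemisimpleRing.ideal_eq_span_idempotent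
    (P.map (Ideal.Quotient.mk (Ideal.span {a})))
  obtain ⟨e, he, hex⟩ := exists_isIdempotentElem_eq_of_ker_isNilpotent
    (Ideal.Quotient.mk (Ideal.span {a}))
    (by
      intro z hz
      rw [Ideal.mk_ker, Ideal.mem_span_singleton] at hz
      obtain ⟨c, rfl⟩ := hz
      exact (Commute.all _ _).isNilpotent_mul_right ha)
    x (hsurj x) hxi
  have hcomap : (P.map (Ideal.Quotient.mk (Ideal.span {a}))).comap
      (Ideal.Quotient.mk (Ideal.span {a})) = P := by
    rw [Ideal.comap_map_of_surjective' _ hsurj, Ideal.mk_ker, sup_eq_left,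
      Ideal.span_singleton_le_iff_mem]
    exact haP
  have heP : e ∈ P := by rw [← hcomap, Ideal.mem_comap, hex, hx]; exact Ideal.mem_span_singleton_self x
  have hP' : P = Ideal.span {e, a} := by
    apply le_antisymm
    · intro z hz
      have h := Ideal.mem_map_of_mem (Ideal.Quotient.mk (Ideal.span {a})) hz
      rw [hx, Ideal.mem_span_singleton'] at h
      obtain ⟨w, hw⟩ := h
      obtain ⟨w, rfl⟩ := hsurj w
      rw [← hex, ← map_mul, Ideal.Quotient.mk_eq_mk_iff_sub_mem, Ideal.mem_span_singleton'] at hw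
      obtain ⟨c, hc⟩ := hw
      exact Ideal.mem_span_pair.2 ⟨w, -c, by linear_combination -hc⟩
    · rw [Ideal.span_le, Set.insert_subset_iff, Set.singleton_subset_iff]
      exact ⟨heP, haP⟩
  rw [hP', Ideal.span_pair_eq_span_singleton_of_isIdempotentElem he]
  exact ⟨_, rfl⟩

theorem IsLocalRing.of_ideal_le_total {R : Type*} [CommRing R] [Nontrivial R]
    (h : ∀ I J : Ideal R, I ≤ J ∨ J ≤ I) : IsLocalRing R := by
  refine IsLocalRing.of_isUnit_or_isUnit_of_isUnit_add fun a b hab ↦ ?_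
  rcases h (Ideal.span {a}) (Ideal.span {b}) with h | h <;>
    rw [Ideal.span_singleton_le_span_singleton] at h
  · exact Or.inr (isUnit_of_dvd_unit (dvd_add h dvd_rfl) hab)
  · exact Or.inl (isUnit_of_dvd_unit (dvd_add dvd_rfl h) hab)

/-- If `n` and the constant term are units, `R[X] ⧸ (X ^ n - u)` is a principal ideal ring. -/
theorem isPrincipalIdealRing_quotient_X_pow_sub_C {R : Type*} [CommRing R] [Finite R]
    [IsLocalRing R] {π : R} (hm : IsLocalRing.maximalIdeal R = Ideal.span {π})
    (hπ : IsNilpotent π) {n : ℕ} (hn : IsUnit (n : R)) (u : Rˣ) :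
    IsPrincipalIdealRing (R[X] ⧸ Ideal.span {X ^ n - C (u : R)}) := by
  have hn0 : n ≠ 0 := by rintro rfl; simp at hn
  have hmax : (Ideal.span {π}).IsMaximal := hm ▸ inferInstance
  let : Field (R ⧸ Ideal.span {π}) := Ideal.Quotient.field _
  set f : R[X] := X ^ n - C (u : R) with hf
  have hfm : f.map (Ideal.Quotient.mk (Ideal.span {π})) =
      X ^ n - C (Ideal.Quotient.mk (Ideal.span {π}) u) := by simp [hf]
  have hsep : (f.map (Ideal.Quotient.mk (Ideal.span {π}))).Separable := by
    rw [hfm]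
    refine separable_X_pow_sub_C _ ?_ ?_
    · have := (hn.map (Ideal.Quotient.mk (Ideal.span {π}))).ne_zero
      simpa using this
    · exact (u.isUnit.map (Ideal.Quotient.mk (Ideal.span {π}))).ne_zero
  have hmonic : f.Monic := monic_X_pow_sub_C _ hn0
  let E := AdjoinRoot.quotAdjoinRootEquivQuotPolynomialQuot (Ideal.span {π}) f
  have hmap : (Ideal.span {π}).map (AdjoinRoot.of f) = Ideal.span {AdjoinRoot.of f π} := by
    rw [Ideal.map_span, Set.image_singleton]
  rw [hmap] at E
  have hred : IsReduced ((R ⧸ Ideal.span {π})[X] ⧸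
      Ideal.span {f.map (Ideal.Quotient.mk (Ideal.span {π}))}) := by
    rw [← Ideal.isRadical_iff_quotient_reduced, ← isRadical_iff_span_singleton]
    exact hsep.squarefree.isRadical
  have : Module.Finite R (AdjoinRoot f) := hmonic.finite_adjoinRoot
  have : Finite (AdjoinRoot f) := Module.finite_of_finite R
  have : Finite (AdjoinRoot f ⧸ Ideal.span {AdjoinRoot.of f π}) :=
    Finite.of_surjective _ Ideal.Quotient.mk_surjective
  have : IsReduced (AdjoinRoot f ⧸ Ideal.span {AdjoinRoot.of f π}) :=
    isReduced_of_injective E E.injective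
  exact IsPrincipalIdealRing.of_isReduced_quotient_span_singleton (S := AdjoinRoot f)
    (hπ.map (AdjoinRoot.of f))

/-- If `f` has a root `μ` that is a multiple root modulo `π`, and `π ≠ 0` generates the maximal
ideal of the local ring `R`, then the ideal `(π, X - μ)` of `R[X] ⧸ (f)` is not
principal. -/
theorem not_isPrincipalIdealRing_quotient_of_eval_eq_zero {R : Type*} [CommRing R]
    [IsLocalRing R] {π : R} (hm : IsLocalRing.maximalIdeal R = Ideal.span {π}) (hπ0 : π ≠ 0)
    {f : R[X]} {μ : R} (hf : f.eval μ = 0) (hf' : π ∣ f.derivative.eval μ) :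
    ¬ IsPrincipalIdealRing (R[X] ⧸ Ideal.span {f}) := by
  intro hP
  have hnu : ¬ π ∣ 1 := fun h ↦ by
    have : (1 : R) ∈ IsLocalRing.maximalIdeal R := by rwa [hm, Ideal.mem_span_singleton]
    exact (IsLocalRing.mem_maximalIdeal _).1 this isUnit_one
  have hsurj := Ideal.Quotient.mk_surjective (I := Ideal.span {f})
  obtain ⟨z, hz⟩ := (hP.principal
    ((Ideal.span {C π, X - C μ}).map (Ideal.Quotient.mk (Ideal.span {f})))).principal
  obtain ⟨h, rfl⟩ := hsurj z
  rw [Ideal.submodule_span_eq] at hz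
  have hlift : ∀ g ∈ Ideal.span {C π, X - C μ}, ∃ a c, g = a * h + c * f := by
    intro g hg
    have := Ideal.mem_map_of_mem (Ideal.Quotient.mk (Ideal.span {f})) hg
    rw [hz, Ideal.mem_span_singleton'] at this
    obtain ⟨a, ha⟩ := this
    obtain ⟨a, rfl⟩ := hsurj a
    rw [← map_mul, eq_comm, Ideal.Quotient.mk_eq_mk_iff_sub_mem, Ideal.mem_span_singleton'] at ha
    obtain ⟨c, hc⟩ := ha
    exact ⟨a, c, by linear_combination -hc⟩
  have hh : π ∣ h.eval μ := by
    have : Ideal.Quotient.mk (Ideal.span {f}) h ∈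
        (Ideal.span {C π, X - C μ}).map (Ideal.Quotient.mk (Ideal.span {f})) :=
      hz ▸ Ideal.mem_span_singleton_self _
    obtain ⟨g, hg, hgh⟩ := (Ideal.mem_map_iff_of_surjective _ hsurj).1 this
    rw [Ideal.Quotient.mk_eq_mk_iff_sub_mem, Ideal.mem_span_singleton'] at hgh
    obtain ⟨c, hc⟩ := hgh
    obtain ⟨r, s, hrs⟩ := Ideal.mem_span_pair.1 hg
    have e1 := congrArg (eval μ) hc
    have e2 := congrArg (eval μ) hrs
    simp only [eval_mul, eval_add, eval_sub, eval_C, eval_X, hf] at e1 e2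
    exact ⟨r.eval μ, by linear_combination e1 - e2⟩
  obtain ⟨a, c, hac⟩ := hlift (C π) (Ideal.subset_span (by simp))
  obtain ⟨b, d, hbd⟩ := hlift (X - C μ) (Ideal.subset_span (by simp))
  have e1 := congrArg (eval μ) hac
  have e2 := congrArg (fun p ↦ eval μ (derivative p)) hac
  have e3 := congrArg (fun p ↦ eval μ (derivative p)) hbd
  simp only [derivative_add, derivative_sub, derivative_mul, derivative_C, derivative_X, eval_mul,
    eval_add, eval_sub, eval_C, eval_zero, eval_one, hf] at e1 e2 e3
  obtain ⟨t, ht⟩ := hh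
  obtain ⟨w, hw⟩ := hf'
  have hua : IsUnit (a.eval μ) := by
    by_contra hua
    have h1 : IsUnit (1 - a.eval μ * t) := by
      rcases IsLocalRing.isUnit_or_isUnit_one_sub_self (a.eval μ * t) with h | h
      · exact absurd (isUnit_of_mul_isUnit_left h) hua
      · exact h
    refine hπ0 (h1.mul_right_eq_zero.1 ?_)
    rw [ht] at e1
    linear_combination e1
  have hh' : π ∣ h.derivative.eval μ := by
    rw [← hua.dvd_mul_left]
    exact ⟨-(a.derivative.eval μ * t + c.eval μ * w), by
      rw [ht, hw] at e2; linear_combination -e2⟩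
  obtain ⟨v, hv⟩ := hh'
  refine hnu ⟨b.derivative.eval μ * t + b.eval μ * v + d.eval μ * w, ?_⟩
  rw [ht, hv, hw] at e3
  linear_combination e3

theorem isUnit_natCast_of_coprime_ringChar {R : Type*} [CommRing R] {n : ℕ}
    (h : n.Coprime (ringChar R)) : IsUnit (n : R) := by
  have := congrArg (Int.cast : ℤ → R) (Nat.gcd_eq_gcd_ab n (ringChar R))
  rw [h.gcd_eq_one] at this
  push_cast [ringChar.Nat.cast_ringChar] at this
  exact IsUnit.of_mul_eq_one _ (by simpa using this.symm)

theorem not_isUnit_natCast_of_not_coprime_ringChar {R : Type*} [CommRing R] [Finite R]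
    {n : ℕ} (h : ¬ n.Coprime (ringChar R)) : ¬ IsUnit (n : R) := by
  intro hu
  obtain ⟨q, hq, ⟨m, rfl⟩, c, hc⟩ := Nat.Prime.not_coprime_iff_dvd.1 h
  have hqu : IsUnit (q : R) := isUnit_of_mul_isUnit_left (by simpa using hu)
  have h0 : (q : R) * c = 0 := by
    rw [← Nat.cast_mul, ← hc, ringChar.Nat.cast_ringChar]
  have hdvd : ringChar R ∣ c := ringChar.dvd (hqu.mul_right_eq_zero.1 h0)
  have hpos : 0 < ringChar R := Nat.pos_of_ne_zero (CharP.ringChar_ne_zero_of_finite R)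
  have hcpos : 0 < c := Nat.pos_of_ne_zero (by rintro rfl; simp at hc; omega)
  have := Nat.le_of_dvd hcpos hdvd
  have := hq.two_le
  nlinarith

/-- Let `R` be a finite chain ring with radical `J(R) = Rπ` of nilpotency index `ℓ`, `n > 1`,
and `λ` a unit of `R` with `gcd(n, ord(λ)) = 1`.  Then `R[X]/⟨X^n−λ⟩` is a principal ideal
ring iff `min{ℓ, gcd(n, char R)} = 1`, i.e. iff `R` is a field or `n` is coprime to
`char R`. -/
theorem stmt_17 {R : Type*} [CommRing R] [Fintype R]
    (hchain : ∀ I J : Ideal R, I ≤ J ∨ J ≤ I)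
    (π : R) (hJ : Ideal.jacobson (⊥ : Ideal R) = Ideal.span {π})
    (ℓ : ℕ) (hℓ : 0 < ℓ) (hnil : π ^ ℓ = 0) (hnil' : π ^ (ℓ - 1) ≠ 0)
    (n : ℕ) (hn : 1 < n) (lam : Rˣ) (hcop : Nat.Coprime n (orderOf lam)) :
    IsPrincipalIdealRing (Polynomial R ⧸ Ideal.span {X ^ n - Polynomial.C ((lam : R))}) ↔
      min ℓ (Nat.gcd n (ringChar R)) = 1 := by
  have : Nontrivial R := ⟨_, _, hnil'⟩
  have : IsLocalRing R := IsLocalRing.of_ideal_le_total hchain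
  have hm : IsLocalRing.maximalIdeal R = Ideal.span {π} := by
    rw [← hJ, IsLocalRing.jacobson_eq_maximalIdeal _ bot_ne_top]
  have hgcd : 0 < n.gcd (ringChar R) := Nat.gcd_pos_of_pos_left _ (by omega)
  constructor
  · intro hP
    by_contra hmin
    have hℓ2 : ℓ ≠ 1 := by omega
    have hg : ¬ n.Coprime (ringChar R) := fun h ↦ by
      rw [Nat.Coprime] at h; omega
    obtain ⟨m, hm'⟩ := exists_pow_eq_self_of_coprime hcop
    have hπ0 : π ≠ 0 := fun h ↦ hnil' (by rw [h, zero_pow (by omega)])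
    have hroot : ((lam ^ m : Rˣ) : R) ^ n = lam := by
      rw [← Units.val_pow_eq_pow_val, ← pow_mul, mul_comm, pow_mul, hm']
    refine not_isPrincipalIdealRing_quotient_of_eval_eq_zero hm hπ0
      (μ := ((lam ^ m : Rˣ) : R)) ?_ ?_ hP
    · simp only [eval_sub, eval_pow, eval_X, eval_C, hroot, sub_self]
    · have hπn : π ∣ (n : R) := by
        rw [← Ideal.mem_span_singleton, ← hm, IsLocalRing.mem_maximalIdeal]
        exact not_isUnit_natCast_of_not_coprime_ringChar hg
      simpa [derivative_X_pow] using hπn.mul_right (((lam ^ m : Rˣ) : R) ^ (n - 1))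
  · intro hmin
    by_cases hℓ1 : ℓ = 1
    · have hπ0 : π = 0 := by simpa [hℓ1] using hnil
      have hfield : IsField R := by
        rw [IsLocalRing.isField_iff_maximalIdeal_eq, hm, hπ0, Ideal.span_singleton_eq_bot]
      let := hfield.toField
      exact IsPrincipalIdealRing.of_surjective (Ideal.Quotient.mk _)
        Ideal.Quotient.mk_surjective
    · have hg : n.Coprime (ringChar R) := by
        rw [Nat.Coprime]; omega
      exact isPrincipalIdealRing_quotient_X_pow_sub_C hm ⟨ℓ, hnil⟩
        (isUnit_natCast_of_coprime_ringChar hg) lam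
end
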